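/- arXiv:1308.4018 — 2 statements merged into one kernel-verified Lean document; each statement's English description precedes it below -/
import Mathlib

section
/- Let (Ω, μ) be a σ-finite measure space and let A : Ω → ℝ^{n×n} be a random matrix such that A(x) is symmetric for every x ∈ Ω. Then there exist measurable functions λ_1, …, λ_n : Ω → ℝ with λ_1(x) ≤ ⋯ ≤ λ_n(x) for every x, and measurable functions u_1, …, u_n : Ω → ℝ^n, such that for every x ∈ Ω the set {u_1(x), …, u_n(x)} is an orthonormal basis of ℝ^n and A(x) u_j(x) = λ_j(x) u_j(x) for every j = 1, …, n. In particular, the ordered eigenvalue functions of a real symmetric random matrix are measurable. -/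
open Matrix MeasureTheory

/-- One minimisation step of the measurable selection. -/
theorem msel_step {Ω Y : Type*} [MeasurableSpace Ω] [TopologicalSpace Y]
    (F : Ω → Set Y) (hc : ∀ x, IsCompact (F x)) (hne : ∀ x, (F x).Nonempty)
    (hm : ∀ C : Set Y, IsClosed C → MeasurableSet {x | (F x ∩ C).Nonempty})
    (f : Y → ℝ) (hf : Continuous f) :
    ∃ m : Ω → ℝ, Measurable m ∧
      (∀ x, IsCompact (F x ∩ {y | f y = m x})) ∧
      (∀ x, (F x ∩ {y | f y = m x}).Nonempty) ∧
      (∀ C : Set Y, IsClosed C →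
        MeasurableSet {x | ((F x ∩ {y | f y = m x}) ∩ C).Nonempty}) := by
  have h1 : ∀ x, ∃ y ∈ F x, IsMinOn f (F x) y := fun x =>
    (hc x).exists_isMinOn (hne x) hf.continuousOn
  choose y hy hmin using h1
  have hmm : Measurable fun x => f (y x) := by
    refine measurable_of_Iic fun a => ?_
    have := hm {z | f z ≤ a} (isClosed_le hf continuous_const)
    convert this using 1
    ext x
    constructor
    · intro h
      exact ⟨y x, hy x, h⟩
    · rintro ⟨z, hz, hza⟩
      have h1 : f (y x) ≤ f z := hmin x hz
      have h2 : f z ≤ a := hza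
      exact h1.trans h2
  refine ⟨fun x => f (y x), hmm, fun x => ?_, fun x => ⟨y x, hy x, rfl⟩, fun C hC => ?_⟩
  · exact (hc x).inter_right (isClosed_eq hf continuous_const)
  · have key : {x | ((F x ∩ {z | f z = f (y x)}) ∩ C).Nonempty} =
        {x | (F x ∩ C).Nonempty} ∩ ⋂ q : ℚ, ({x | (q : ℝ) < f (y x)} ∪
          {x | (F x ∩ (C ∩ {z | f z ≤ q})).Nonempty}) := by
      ext x
      simp only [Set.mem_inter_iff, Set.mem_iInter, Set.mem_union, Set.mem_ofPred_eq]
      constructor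
      · rintro ⟨z, ⟨hz, hzf⟩, hzC⟩
        refine ⟨⟨z, hz, hzC⟩, fun q => ?_⟩
        rcases lt_or_ge (q : ℝ) (f (y x)) with h | h
        · exact Or.inl h
        · exact Or.inr ⟨z, hz, hzC, hzf.le.trans h⟩
      · rintro ⟨hn, hq⟩
        obtain ⟨z, ⟨hz, hzC⟩, hzmin⟩ :=
          ((hc x).inter_right hC).exists_isMinOn hn hf.continuousOn
        refine ⟨z, ⟨hz, le_antisymm ?_ (hmin x hz)⟩, hzC⟩
        by_contra hlt
        push Not at hlt
        obtain ⟨q, hq1, hq2⟩ := exists_rat_btwn hlt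
        rcases hq q with h | ⟨w, hw, hwC, hwq⟩
        · exact absurd h (not_lt.2 hq1.le)
        · have h2 : f z ≤ f w := hzmin ⟨hw, hwC⟩
          have h3 : f w ≤ q := hwq
          linarith
    rw [key]
    refine (hm C hC).inter (MeasurableSet.iInter fun q => ?_)
    exact (measurableSet_lt measurable_const hmm).union
      (hm _ (hC.inter (isClosed_le hf continuous_const)))

/-- Iterated (lexicographic) minimisation. -/
theorem msel_list {Ω Y : Type*} [MeasurableSpace Ω] [TopologicalSpace Y]
    (l : List (Y → ℝ)) (hl : ∀ f ∈ l, Continuous f) :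
    ∀ (F : Ω → Set Y) (_ : ∀ x, IsCompact (F x)) (_ : ∀ x, (F x).Nonempty)
    (_ : ∀ C : Set Y, IsClosed C → MeasurableSet {x | (F x ∩ C).Nonempty}),
    ∃ y : Ω → Y, (∀ x, y x ∈ F x) ∧ ∀ f ∈ l, Measurable fun x => f (y x) := by
  induction l with
  | nil =>
    intro F _ hne _
    choose y hy using hne
    exact ⟨y, hy, by simp⟩
  | cons f l ih =>
    intro F hc hne hm
    obtain ⟨m, hmm, h1, h2, h3⟩ := msel_step F hc hne hm f (hl f (by simp))
    obtain ⟨y, hy, hyl⟩ := ih (fun g hg => hl g (by simp [hg])) _ h1 h2 h3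
    refine ⟨y, fun x => (hy x).1, fun g hg => ?_⟩
    rcases List.mem_cons.1 hg with rfl | hg
    · have : (fun x => g (y x)) = m := funext fun x => (hy x).2
      rw [this]
      exact hmm
    · exact hyl g hg

/-- Pointwise spectral theorem with increasing eigenvalues. -/
theorem msel_spectral (n : ℕ) (B : Matrix (Fin n) (Fin n) ℝ) (hB : B.IsSymm) :
    ∃ u : Fin n → Fin n → ℝ, (∀ i j, u i ⬝ᵥ u j = if i = j then (1 : ℝ) else 0) ∧
      (∀ i j, i ≤ j → u i ⬝ᵥ B *ᵥ u i ≤ u j ⬝ᵥ B *ᵥ u j) ∧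
      (∀ j, B *ᵥ u j = (u j ⬝ᵥ B *ᵥ u j) • u j) := by
  have hH : B.IsHermitian := by
    rw [Matrix.IsHermitian, Matrix.conjTranspose_eq_transpose_of_trivial]
    exact hB
  let σ := Tuple.sort hH.eigenvalues
  let u : Fin n → Fin n → ℝ := fun j => (hH.eigenvectorBasis (σ j)).ofLp
  have ho : ∀ i j, u i ⬝ᵥ u j = if i = j then (1 : ℝ) else 0 := by
    intro i j
    have := (orthonormal_iff_ite.1 hH.eigenvectorBasis.orthonormal) (σ j) (σ i)
    rw [EuclideanSpace.inner_eq_star_dotProduct] at this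
    simp only [star_trivial, EmbeddingLike.apply_eq_iff_eq] at this
    simp only [u, this, eq_comm]
  have he : ∀ j, B *ᵥ u j = hH.eigenvalues (σ j) • u j := fun j =>
    hH.mulVec_eigenvectorBasis (σ j)
  have hr : ∀ j, u j ⬝ᵥ B *ᵥ u j = hH.eigenvalues (σ j) := fun j => by
    rw [he, dotProduct_smul, ho]; simp
  refine ⟨u, ho, fun i j hij => ?_, fun j => ?_⟩
  · rw [hr, hr]
    exact Tuple.monotone_sort hH.eigenvalues hij
  · rw [hr, he]

/-- Orthonormal families form a compact set. -/
theorem msel_compact (n : ℕ) : IsCompact {u : Fin n → Fin n → ℝ |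
    ∀ i j, u i ⬝ᵥ u j = if i = j then (1 : ℝ) else 0} := by
  have hK : IsCompact (Set.univ.pi fun _ : Fin n => Set.univ.pi fun _ : Fin n =>
      Set.Icc (-1 : ℝ) 1) :=
    isCompact_univ_pi fun _ => isCompact_univ_pi fun _ => isCompact_Icc
  refine hK.of_isClosed_subset ?_ ?_
  · simp only [Set.ofPred_forall, dotProduct]
    exact isClosed_iInter fun i => isClosed_iInter fun j =>
      isClosed_eq (by fun_prop) continuous_const
  · intro u hu i _ k _
    have h1 : u i ⬝ᵥ u i = 1 := by simpa using hu i i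
    have h2 : u i k * u i k ≤ u i ⬝ᵥ u i :=
      Finset.single_le_sum (f := fun k => u i k * u i k)
        (fun k _ => mul_self_nonneg _) (Finset.mem_univ k)
    rw [h1] at h2
    exact abs_le.1 (abs_le_one_iff_mul_self_le_one.2 h2)

/-- The closed relation between a matrix and its ordered eigenbases. -/
theorem msel_closed (n : ℕ) : IsClosed {p : (Fin n → Fin n → ℝ) × (Fin n → Fin n → ℝ) |
    (∀ i j, i ≤ j → p.2 i ⬝ᵥ Matrix.of p.1 *ᵥ p.2 i ≤ p.2 j ⬝ᵥ Matrix.of p.1 *ᵥ p.2 j) ∧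
    (∀ j, Matrix.of p.1 *ᵥ p.2 j = (p.2 j ⬝ᵥ Matrix.of p.1 *ᵥ p.2 j) • p.2 j)} := by
  have hq : ∀ j, Continuous fun p : (Fin n → Fin n → ℝ) × (Fin n → Fin n → ℝ) =>
      p.2 j ⬝ᵥ Matrix.of p.1 *ᵥ p.2 j := by
    intro j
    simp only [dotProduct, mulVec, Matrix.of_apply]
    fun_prop
  have hv : ∀ j, Continuous fun p : (Fin n → Fin n → ℝ) × (Fin n → Fin n → ℝ) =>
      Matrix.of p.1 *ᵥ p.2 j := by
    intro j
    refine continuous_pi fun i => ?_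
    simp only [dotProduct, mulVec, Matrix.of_apply]
    fun_prop
  refine IsClosed.and ?_ ?_
  · simp only [Set.ofPred_forall]
    exact isClosed_iInter fun i => isClosed_iInter fun j => isClosed_iInter fun _ =>
      isClosed_le (hq i) (hq j)
  · simp only [Set.ofPred_forall]
    exact isClosed_iInter fun j => isClosed_eq (hv j) ((hq j).smul (by fun_prop))

/-- A random real symmetric matrix admits measurable ordered eigenvalue functions
and measurable eigenvector functions forming a pointwise orthonormal basis; in particular the
ordered eigenvalue functions of a real symmetric random matrix are measurable. -/
theorem random_symmetric_measurable_spectral_decomposition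
    {Ω : Type*} [MeasurableSpace Ω] (μ : Measure Ω) [SigmaFinite μ]
    (n : ℕ) (A : Ω → Matrix (Fin n) (Fin n) ℝ)
    (hmeas : ∀ i j, Measurable fun x => A x i j)
    (hsymm : ∀ x, (A x).IsSymm) :
    ∃ (lam : Fin n → Ω → ℝ) (u : Fin n → Ω → (Fin n → ℝ)),
      (∀ j, Measurable (lam j)) ∧
      (∀ (j : Fin n) (k : Fin n), Measurable fun x => u j x k) ∧
      (∀ x, Monotone fun j => lam j x) ∧
      (∀ x, (∀ i j : Fin n, u i x ⬝ᵥ u j x = if i = j then (1 : ℝ) else 0) ∧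
        Submodule.span ℝ (Set.range fun i => u i x) = ⊤) ∧
      (∀ x (j : Fin n), A x *ᵥ u j x = lam j x • u j x) := by
  let K : Set (Fin n → Fin n → ℝ) :=
    {u | ∀ i j, u i ⬝ᵥ u j = if i = j then (1 : ℝ) else 0}
  let S : Set ((Fin n → Fin n → ℝ) × (Fin n → Fin n → ℝ)) := {p |
    (∀ i j, i ≤ j → p.2 i ⬝ᵥ Matrix.of p.1 *ᵥ p.2 i ≤ p.2 j ⬝ᵥ Matrix.of p.1 *ᵥ p.2 j) ∧
    (∀ j, Matrix.of p.1 *ᵥ p.2 j = (p.2 j ⬝ᵥ Matrix.of p.1 *ᵥ p.2 j) • p.2 j)}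
  have hK : IsCompact K := msel_compact n
  have hS : IsClosed S := msel_closed n
  let a : Ω → Fin n → Fin n → ℝ := fun x i j => A x i j
  have ha : Measurable a := measurable_pi_iff.2 fun i => measurable_pi_iff.2 fun j => hmeas i j
  let F : Ω → Set (Fin n → Fin n → ℝ) := fun x => K ∩ {u | (a x, u) ∈ S}
  have hFc : ∀ x, IsCompact (F x) := fun x =>
    hK.inter_right (hS.preimage (Continuous.prodMk_right (a x)))
  have hFn : ∀ x, (F x).Nonempty := fun x => by
    obtain ⟨u, h1, h2, h3⟩ := msel_spectral n (A x) (hsymm x)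
    exact ⟨u, h1, h2, h3⟩
  have hFm : ∀ C : Set (Fin n → Fin n → ℝ), IsClosed C →
      MeasurableSet {x | (F x ∩ C).Nonempty} := by
    intro C hC
    have : CompactSpace K := isCompact_iff_compactSpace.1 hK
    let T : Set ((Fin n → Fin n → ℝ) × K) := {p | (p.1, (p.2 : Fin n → Fin n → ℝ)) ∈ S ∧
      (p.2 : Fin n → Fin n → ℝ) ∈ C}
    have hT : IsClosed T :=
      (hS.preimage (by fun_prop)).inter (hC.preimage (by fun_prop))
    have hP : IsClosed (Prod.fst '' T) := isClosedMap_fst_of_compactSpace _ hT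
    convert ha hP.measurableSet using 1
    ext x
    constructor
    · rintro ⟨u, ⟨hu, hus⟩, huC⟩
      exact ⟨(a x, ⟨u, hu⟩), ⟨hus, huC⟩, rfl⟩
    · rintro ⟨⟨b, u, hu⟩, ⟨hus, huC⟩, hb⟩
      have hb' : b = a x := hb
      subst hb'
      exact ⟨u, ⟨hu, hus⟩, huC⟩
  let l : List ((Fin n → Fin n → ℝ) → ℝ) :=
    (Finset.univ : Finset (Fin n × Fin n)).toList.map fun p u => u p.1 p.2
  obtain ⟨y, hy, hyl⟩ := msel_list l (by
    intro f hf
    obtain ⟨p, -, rfl⟩ := List.mem_map.1 hf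
    fun_prop) F hFc hFn hFm
  have hym : ∀ j k, Measurable fun x => y x j k := fun j k =>
    hyl (fun u => u j k) (List.mem_map.2 ⟨(j, k), by simp, rfl⟩)
  refine ⟨fun j x => y x j ⬝ᵥ A x *ᵥ y x j, fun j x => y x j, fun j => ?_, hym, fun x => ?_,
    fun x => ⟨(hy x).1, ?_⟩, fun x j => (hy x).2.2 j⟩
  · simp only [dotProduct, mulVec]
    fun_prop
  · exact fun i j hij => (hy x).2.1 i j hij
  · have ho : ∀ i j, y x i ⬝ᵥ y x j = if i = j then (1 : ℝ) else 0 := (hy x).1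
    have hli : LinearIndependent ℝ fun i => y x i := by
      rw [Fintype.linearIndependent_iff]
      intro g hg i
      have := congrArg (fun v => y x i ⬝ᵥ v) hg
      simpa [dotProduct_sum, dotProduct_smul, ho] using this
    exact hli.span_eq_top_of_card_eq_finrank' (by simp)
end

section
/- Let (Ω, μ) be a σ-finite measure space, let A : Ω → ℂ^{n×n} be a random matrix such that A(x) is Hermitian for every x ∈ Ω, and let 1 ≤ k ≤ n. Then: (i) for every family of measurable functions w_1, …, w_{n−k} : Ω → ℂ^n and every x ∈ Ω, λ_k(A(x)) ≤ sup { v* A(x) v / v* v : v ∈ ℂ^n, v ≠ 0, v ⊥ w_i(x) for i = 1, …, n−k }; and (ii) there exists a family of measurable functions w_1, …, w_{n−k} : Ω → ℂ^n for which equality holds at every x ∈ Ω. That is, the Courant–Fischer min-max characterization of λ_k holds with the minimum over random vector families attained uniformly in x. -/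
open Matrix MeasureTheory

/-- The eigenvalues of a Hermitian matrix, sorted in increasing order
(`sortedEigenvalues hA ⟨k, _⟩` is the `(k+1)`-th smallest eigenvalue, with multiplicity). -/
noncomputable def sortedEigenvalues {n : ℕ} {A : Matrix (Fin n) (Fin n) ℂ}
    (hA : A.IsHermitian) : Fin n → ℝ :=
  hA.eigenvalues ∘ Tuple.sort hA.eigenvalues

/-- One step of the lexicographic selection: minimise a continuous function. -/
theorem selection_step {Ω E : Type*} [MeasurableSpace Ω] [TopologicalSpace E]
    (F : Ω → Set E) (hc : ∀ x, IsCompact (F x)) (hn : ∀ x, (F x).Nonempty)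
    (hm : ∀ C, IsClosed C → MeasurableSet {x | (F x ∩ C).Nonempty})
    (g : E → ℝ) (hg : Continuous g) :
    ∃ G : Ω → Set E, (∀ x, G x ⊆ F x) ∧ (∀ x, IsCompact (G x)) ∧ (∀ x, (G x).Nonempty) ∧
      (∀ C, IsClosed C → MeasurableSet {x | (G x ∩ C).Nonempty}) ∧
      ∀ x, ∀ y ∈ G x, ∀ z ∈ G x, g y = g z := by
  refine ⟨fun x => F x ∩ {y | ∀ z ∈ F x, g y ≤ g z}, fun x => Set.inter_subset_left, ?_, ?_, ?_, ?_⟩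
  · intro x
    refine (hc x).inter_right ?_
    have : {y | ∀ z ∈ F x, g y ≤ g z} = ⋂ z ∈ F x, {y | g y ≤ g z} := by ext; simp
    rw [this]
    exact isClosed_biInter fun z _ => isClosed_le hg continuous_const
  · intro x
    obtain ⟨y, hy, h⟩ := (hc x).exists_isMinOn (hn x) hg.continuousOn
    exact ⟨y, hy, fun z hz => h hz⟩
  · intro C hC
    have key : {x | (F x ∩ {y | ∀ z ∈ F x, g y ≤ g z} ∩ C).Nonempty} =
        ⋂ q : ℚ, ({x | (F x ∩ {z | g z ≤ q}).Nonempty}ᶜ ∪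
          {x | (F x ∩ (C ∩ {z | g z ≤ q})).Nonempty}) := by
      ext x
      simp only [Set.mem_iInter, Set.mem_union, Set.mem_compl_iff, Set.mem_ofPred_eq]
      constructor
      · rintro ⟨y, ⟨hy, hy2⟩, hyC⟩ q
        by_cases h : (F x ∩ {z | g z ≤ q}).Nonempty
        · obtain ⟨z, hz, hzq⟩ := h
          exact Or.inr ⟨y, hy, hyC, (hy2 z hz).trans hzq⟩
        · exact Or.inl h
      · intro h
        have hne : (F x ∩ C).Nonempty := by
          obtain ⟨z, hz⟩ := hn x
          obtain ⟨q, hq⟩ := exists_rat_gt (g z)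
          rcases h q with h | ⟨y, hy, hyC, _⟩
          · exact absurd ⟨z, hz, hq.le⟩ h
          · exact ⟨y, hy, hyC⟩
        obtain ⟨y, hy, hmin⟩ := ((hc x).inter_right hC).exists_isMinOn hne hg.continuousOn
        refine ⟨y, ⟨hy.1, fun z hz => ?_⟩, hy.2⟩
        by_contra! hlt
        obtain ⟨q, hq1, hq2⟩ := exists_rat_btwn hlt
        rcases h q with h | ⟨y', hy', hyC', hq'⟩
        · exact h ⟨z, hz, hq1.le⟩
        · have h1 : g y ≤ g y' := hmin ⟨hy', hyC'⟩
          have h2 : g y' ≤ q := hq'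
          linarith
    rw [key]
    refine MeasurableSet.iInter fun q => ?_
    have hq : IsClosed {z | g z ≤ (q : ℝ)} := isClosed_le hg continuous_const
    exact (hm _ hq).compl.union (hm _ (hC.inter hq))
  · intro x y hy z hz
    exact le_antisymm (hy.2 z hz.1) (hz.2 y hy.1)

theorem selection_iterate {Ω E ι : Type*} [MeasurableSpace Ω] [TopologicalSpace E]
    (F : Ω → Set E) (hc : ∀ x, IsCompact (F x)) (hn : ∀ x, (F x).Nonempty)
    (hm : ∀ C, IsClosed C → MeasurableSet {x | (F x ∩ C).Nonempty})
    (g : ι → E → ℝ) (hg : ∀ i, Continuous (g i)) (s : Finset ι) :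
    ∃ G : Ω → Set E, (∀ x, G x ⊆ F x) ∧ (∀ x, IsCompact (G x)) ∧ (∀ x, (G x).Nonempty) ∧
      (∀ C, IsClosed C → MeasurableSet {x | (G x ∩ C).Nonempty}) ∧
      ∀ i ∈ s, ∀ x, ∀ y ∈ G x, ∀ z ∈ G x, g i y = g i z := by
  classical
  induction s using Finset.induction_on with
  | empty => exact ⟨F, fun x => subset_rfl, hc, hn, hm, by simp⟩
  | insert a s ha ih =>
    obtain ⟨G, h1, h2, h3, h4, h5⟩ := ih
    obtain ⟨H, k1, k2, k3, k4, k5⟩ := selection_step G h2 h3 h4 (g a) (hg a)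
    refine ⟨H, fun x => (k1 x).trans (h1 x), k2, k3, k4, ?_⟩
    intro i hi x y hy z hz
    rcases Finset.mem_insert.1 hi with rfl | hi
    · exact k5 x y hy z hz
    · exact h5 i hi x y (k1 x hy) z (k1 x hz)

theorem measurable_selection {Ω E ι : Type*} [MeasurableSpace Ω] [TopologicalSpace E]
    [MeasurableSpace E] [BorelSpace E] [Finite ι]
    (F : Ω → Set E) (hc : ∀ x, IsCompact (F x)) (hn : ∀ x, (F x).Nonempty)
    (hm : ∀ C, IsClosed C → MeasurableSet {x | (F x ∩ C).Nonempty})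
    (g : ι → E → ℝ) (hg : ∀ i, Continuous (g i)) (hsep : ∀ y z, (∀ i, g i y = g i z) → y = z) :
    ∃ f : Ω → E, Measurable f ∧ ∀ x, f x ∈ F x := by
  have := Fintype.ofFinite ι
  obtain ⟨G, h1, h2, h3, h4, h5⟩ := selection_iterate F hc hn hm g hg Finset.univ
  choose f hf using h3
  refine ⟨f, measurable_of_isClosed fun C hC => ?_, fun x => h1 x (hf x)⟩
  convert h4 C hC using 1
  ext x
  constructor
  · intro h
    exact ⟨f x, hf x, h⟩
  · rintro ⟨y, hy, hyC⟩
    have : f x = y := hsep _ _ fun i => h5 i (Finset.mem_univ i) x _ (hf x) _ hy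
    change f x ∈ C
    rwa [this]

/-- Coordinates of a vector in the eigenbasis. -/
noncomputable def eigCoord {n : ℕ} {A : Matrix (Fin n) (Fin n) ℂ} (hA : A.IsHermitian)
    (i : Fin n) (v : Fin n → ℂ) : ℂ :=
  star (fun j => (hA.eigenvectorUnitary : Matrix (Fin n) (Fin n) ℂ) j
    (Tuple.sort hA.eigenvalues i)) ⬝ᵥ v

theorem eigCoord_eq {n : ℕ} {A : Matrix (Fin n) (Fin n) ℂ} (hA : A.IsHermitian)
    (i : Fin n) (v : Fin n → ℂ) : eigCoord hA i v =
    (star (hA.eigenvectorUnitary : Matrix (Fin n) (Fin n) ℂ) *ᵥ v)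
      (Tuple.sort hA.eigenvalues i) := by
  simp [eigCoord, mulVec, dotProduct, star_apply]

theorem star_dot_re {n : ℕ} (v : Fin n → ℂ) : (star v ⬝ᵥ v).re = ∑ i, ‖v i‖ ^ 2 := by
  simp only [dotProduct, Complex.re_sum, Pi.star_apply]
  refine Finset.sum_congr rfl fun i _ => ?_
  rw [← Complex.normSq_eq_norm_sq, Complex.normSq_apply]
  simp

theorem norm_expand {n : ℕ} {A : Matrix (Fin n) (Fin n) ℂ} (hA : A.IsHermitian)
    (v : Fin n → ℂ) : (star v ⬝ᵥ v).re = ∑ i, ‖eigCoord hA i v‖ ^ 2 := by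
  simp only [eigCoord_eq]
  rw [Equiv.sum_comp (Tuple.sort hA.eigenvalues) (fun i => ‖(star
    (hA.eigenvectorUnitary : Matrix (Fin n) (Fin n) ℂ) *ᵥ v) i‖ ^ 2), ← star_dot_re,
    star_mulVec, ← dotProduct_mulVec, mulVec_mulVec, star_eq_conjTranspose,
    conjTranspose_conjTranspose, ← star_eq_conjTranspose, (Unitary.mem_iff.1 hA.eigenvectorUnitary.2).2, one_mulVec]

theorem rayleigh_expand {n : ℕ} {A : Matrix (Fin n) (Fin n) ℂ} (hA : A.IsHermitian)
    (v : Fin n → ℂ) : (star v ⬝ᵥ (A *ᵥ v)).re =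
      ∑ i, sortedEigenvalues hA i * ‖eigCoord hA i v‖ ^ 2 := by
  simp only [eigCoord_eq, sortedEigenvalues, Function.comp]
  rw [Equiv.sum_comp (Tuple.sort hA.eigenvalues) (fun i => hA.eigenvalues i * ‖(star
    (hA.eigenvectorUnitary : Matrix (Fin n) (Fin n) ℂ) *ᵥ v) i‖ ^ 2)]
  set U := (hA.eigenvectorUnitary : Matrix (Fin n) (Fin n) ℂ) with hU
  have hs : A = U * diagonal (RCLike.ofReal ∘ hA.eigenvalues) * star U := by
    have := hA.spectral_theorem
    rwa [Unitary.conjStarAlgAut_apply] at this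
  have : star v ⬝ᵥ (A *ᵥ v) = star (star U *ᵥ v) ⬝ᵥ
      (diagonal (RCLike.ofReal ∘ hA.eigenvalues) *ᵥ (star U *ᵥ v)) := by
    conv_lhs => rw [hs]
    rw [star_mulVec, ← dotProduct_mulVec, mulVec_mulVec, mulVec_mulVec, star_eq_conjTranspose,
      conjTranspose_conjTranspose, Matrix.mul_assoc]
  rw [this]
  generalize star U *ᵥ v = y
  simp only [dotProduct, Complex.re_sum, Pi.star_apply, mulVec_diagonal, Function.comp]
  refine Finset.sum_congr rfl fun i _ => ?_
  rw [← Complex.normSq_eq_norm_sq, Complex.normSq_apply]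
  simp
  ring

theorem sorted_mono {n : ℕ} {A : Matrix (Fin n) (Fin n) ℂ} (hA : A.IsHermitian) :
    Monotone (sortedEigenvalues hA) := Tuple.monotone_sort _

theorem star_dot_pos {n : ℕ} (v : Fin n → ℂ) (hv : v ≠ 0) : 0 < (star v ⬝ᵥ v).re := by
  rw [star_dot_re]
  obtain ⟨i, hi⟩ := Function.ne_iff.1 hv
  exact Finset.sum_pos' (fun _ _ => by positivity)
    ⟨i, Finset.mem_univ _, by have := norm_pos_iff.2 hi; positivity⟩

/-- Lower bound. -/
theorem exists_lower {n : ℕ} {A : Matrix (Fin n) (Fin n) ℂ} (hA : A.IsHermitian)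
    (k : ℕ) (hk1 : 1 ≤ k) (hkn : k ≤ n) (hlt : k - 1 < n) (w : Fin (n - k) → Fin n → ℂ) :
    ∃ v : Fin n → ℂ, v ≠ 0 ∧ (∀ i, star (w i) ⬝ᵥ v = 0) ∧
      sortedEigenvalues hA ⟨k - 1, hlt⟩ * (star v ⬝ᵥ v).re ≤ (star v ⬝ᵥ (A *ᵥ v)).re := by
  let L : (Fin n → ℂ) →ₗ[ℂ] (Fin (n - k) → ℂ) × (Fin (k - 1) → ℂ) :=
    { toFun := fun v => (fun i => star (w i) ⬝ᵥ v, fun j => eigCoord hA ⟨j, by omega⟩ v)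
      map_add' := fun a b => by ext <;> simp [eigCoord, dotProduct_add]
      map_smul' := fun a b => by ext <;> simp [eigCoord, dotProduct_smul] }
  have hL : LinearMap.ker L ≠ ⊥ := by
    apply LinearMap.ker_ne_bot_of_finrank_lt
    simp
    omega
  obtain ⟨v, hv, hv0⟩ := (Submodule.ne_bot_iff _).1 hL
  have hv' : L v = 0 := hv
  have h1 : ∀ i, star (w i) ⬝ᵥ v = 0 := fun i => congrFun (congrArg Prod.fst hv') i
  have h2 : ∀ j : Fin (k - 1), eigCoord hA ⟨j, by omega⟩ v = 0 :=
    fun i => congrFun (congrArg Prod.snd hv') i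
  refine ⟨v, hv0, h1, ?_⟩
  rw [norm_expand hA, rayleigh_expand hA, Finset.mul_sum]
  refine Finset.sum_le_sum fun i _ => ?_
  by_cases hi : (i : ℕ) < k - 1
  · rw [h2 ⟨i, hi⟩]; simp
  · exact mul_le_mul_of_nonneg_right (sorted_mono hA (by
      rw [Fin.le_def]; simp only; omega)) (by positivity)

/-- Upper bound. -/
theorem upper_bound {n : ℕ} {A : Matrix (Fin n) (Fin n) ℂ} (hA : A.IsHermitian)
    (k : ℕ) (hk1 : 1 ≤ k) (hkn : k ≤ n) (hlt : k - 1 < n) (v : Fin n → ℂ)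
    (hv : ∀ i : Fin n, k ≤ (i : ℕ) → eigCoord hA i v = 0) :
    (star v ⬝ᵥ (A *ᵥ v)).re ≤ sortedEigenvalues hA ⟨k - 1, hlt⟩ * (star v ⬝ᵥ v).re := by
  rw [norm_expand hA, rayleigh_expand hA, Finset.mul_sum]
  refine Finset.sum_le_sum fun i _ => ?_
  by_cases hi : k ≤ (i : ℕ)
  · rw [hv i hi]; simp
  · exact mul_le_mul_of_nonneg_right (sorted_mono hA (by
      rw [Fin.le_def]; simp only; omega)) (by positivity)

/-- Residual of `v` after subtracting the components along the `w i`. -/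
noncomputable def resid {n m : ℕ} (w : Fin m → Fin n → ℂ) (v : Fin n → ℂ) : Fin n → ℂ :=
  v - ∑ i, (star (w i) ⬝ᵥ v) • w i

/-- The closed relation. -/
def goodRel (n m : ℕ) : Set ((Matrix (Fin n) (Fin n) ℂ × ℝ) × (Fin m → Fin n → ℂ)) :=
  {p | ∀ v, (star (resid p.2 v) ⬝ᵥ (p.1.1 *ᵥ resid p.2 v)).re ≤
    p.1.2 * (star (resid p.2 v) ⬝ᵥ resid p.2 v).re}

theorem isClosed_goodRel (n m : ℕ) : IsClosed (goodRel n m) := by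
  have : goodRel n m = ⋂ v, {p | (star (resid p.2 v) ⬝ᵥ (p.1.1 *ᵥ resid p.2 v)).re ≤
    p.1.2 * (star (resid p.2 v) ⬝ᵥ resid p.2 v).re} := by ext; simp [goodRel]
  rw [this]
  refine isClosed_iInter fun v => ?_
  have hr : Continuous fun p : (Matrix (Fin n) (Fin n) ℂ × ℝ) × (Fin m → Fin n → ℂ) =>
      resid p.2 v := by
    unfold resid dotProduct
    simp only [Pi.star_apply]
    fun_prop
  refine isClosed_le (Complex.continuous_re.comp ?_) (Continuous.mul (by fun_prop)
    (Complex.continuous_re.comp ?_))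
  · exact hr.star.dotProduct (Continuous.matrix_mulVec (by fun_prop) hr)
  · exact hr.star.dotProduct hr

theorem resid_of_orth {n m : ℕ} (w : Fin m → Fin n → ℂ) (v : Fin n → ℂ)
    (h : ∀ i, star (w i) ⬝ᵥ v = 0) : resid w v = v := by
  simp [resid, h]

theorem exists_good {n : ℕ} {A : Matrix (Fin n) (Fin n) ℂ} (hA : A.IsHermitian)
    (k : ℕ) (hk1 : 1 ≤ k) (hkn : k ≤ n) (hlt : k - 1 < n) (t : ℝ)
    (ht : sortedEigenvalues hA ⟨k - 1, hlt⟩ ≤ t) :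
    ∃ w ∈ Metric.closedBall (0 : Fin (n - k) → Fin n → ℂ) 1, ((A, t), w) ∈ goodRel n (n - k) := by
  set U := (hA.eigenvectorUnitary : Matrix (Fin n) (Fin n) ℂ) with hU
  let w : Fin (n - k) → Fin n → ℂ := fun i j =>
    U j (Tuple.sort hA.eigenvalues ⟨k + i, by omega⟩)
  refine ⟨w, ?_, ?_⟩
  · rw [mem_closedBall_zero_iff, pi_norm_le_iff_of_nonneg zero_le_one]
    intro i
    rw [pi_norm_le_iff_of_nonneg zero_le_one]
    intro j
    exact entry_norm_bound_of_unitary hA.eigenvectorUnitary.2 _ _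
  · intro v
    have horth : ∀ i j, star (w i) ⬝ᵥ w j = if i = j then 1 else 0 := by
      intro i j
      have : (star U * U) (Tuple.sort hA.eigenvalues ⟨k + i, by omega⟩)
          (Tuple.sort hA.eigenvalues ⟨k + j, by omega⟩) = star (w i) ⬝ᵥ w j := by
        simp [Matrix.mul_apply, dotProduct, w, star_apply]
      rw [← this, hU, Unitary.coe_star_mul_self, Matrix.one_apply]
      simp [Fin.ext_iff]
    have hres : ∀ i, star (w i) ⬝ᵥ resid w v = 0 := by
      intro i
      simp [resid, dotProduct_sub, dotProduct_sum, dotProduct_smul, horth]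
    have hc := upper_bound hA k hk1 hkn hlt (resid w v) (fun i hi => by
      have := hres ⟨i - k, by omega⟩
      have hi' : (⟨k + (i - k), by omega⟩ : Fin n) = i := by ext; simp; omega
      simp only [w, hi'] at this
      exact this)
    refine hc.trans (mul_le_mul_of_nonneg_right ht ?_)
    rw [star_dot_re]; positivity

theorem sorted_le_of_good {n : ℕ} {A : Matrix (Fin n) (Fin n) ℂ} (hA : A.IsHermitian)
    (k : ℕ) (hk1 : 1 ≤ k) (hkn : k ≤ n) (hlt : k - 1 < n) (t : ℝ) (w : Fin (n - k) → Fin n → ℂ)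
    (hw : ((A, t), w) ∈ goodRel n (n - k)) :
    sortedEigenvalues hA ⟨k - 1, hlt⟩ ≤ t := by
  obtain ⟨v, hv0, hv, hle⟩ := exists_lower hA k hk1 hkn hlt w
  have := hw v
  simp only [resid_of_orth w v hv] at this
  exact le_of_mul_le_mul_right (hle.trans this) (star_dot_pos v hv0)

theorem isClosed_hit {X E : Type*} [TopologicalSpace X] [TopologicalSpace E]
    (Z : Set (X × E)) (hZ : IsClosed Z) (K : Set E) (hK : IsCompact K) :
    IsClosed {x | ∃ w ∈ K, (x, w) ∈ Z} := by
  have := isCompact_iff_compactSpace.1 hK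
  have h : IsClosed ((fun p : X × K => (p.1, (p.2 : E))) ⁻¹' Z) := hZ.preimage (by fun_prop)
  have h2 := isClosedMap_fst_of_compactSpace (X := X) (Y := K) _ h
  convert h2 using 1
  ext x
  simp

theorem rayleigh_bdd {n : ℕ} {A : Matrix (Fin n) (Fin n) ℂ} (hA : A.IsHermitian) (hn : 1 ≤ n)
    {m : ℕ} (w : Fin m → Fin n → ℂ) :
    BddAbove {r : ℝ | ∃ v : Fin n → ℂ, v ≠ 0 ∧ (∀ i, star (w i) ⬝ᵥ v = 0) ∧
          r = (star v ⬝ᵥ (A *ᵥ v)).re / (star v ⬝ᵥ v).re} := by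
  refine ⟨sortedEigenvalues hA ⟨n - 1, by omega⟩, ?_⟩
  rintro r ⟨v, hv0, -, rfl⟩
  rw [div_le_iff₀ (star_dot_pos v hv0)]
  exact upper_bound hA n hn le_rfl (by omega) v (fun i hi => by omega)

theorem le_sup {n : ℕ} {A : Matrix (Fin n) (Fin n) ℂ} (hA : A.IsHermitian)
    (k : ℕ) (hk1 : 1 ≤ k) (hkn : k ≤ n) (hlt : k - 1 < n) (w : Fin (n - k) → Fin n → ℂ) :
    sortedEigenvalues hA ⟨k - 1, hlt⟩ ≤
      sSup {r : ℝ | ∃ v : Fin n → ℂ, v ≠ 0 ∧ (∀ i, star (w i) ⬝ᵥ v = 0) ∧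
          r = (star v ⬝ᵥ (A *ᵥ v)).re / (star v ⬝ᵥ v).re} := by
  obtain ⟨v, hv0, hv, hle⟩ := exists_lower hA k hk1 hkn hlt w
  exact ((le_div_iff₀ (star_dot_pos v hv0)).2 hle).trans
    (le_csSup (rayleigh_bdd hA (hk1.trans hkn) w) ⟨v, hv0, hv, rfl⟩)

/-- Measurable selection of optimal families. -/
theorem exists_measurable_good {Ω : Type*} [MeasurableSpace Ω]
    (n k : ℕ) (hk1 : 1 ≤ k) (hkn : k ≤ n) (hlt : k - 1 < n)
    (A : Ω → Matrix (Fin n) (Fin n) ℂ)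
    (hmeas : ∀ i j, Measurable fun x => A x i j)
    (hherm : ∀ x, (A x).IsHermitian) :
    ∃ f : Ω → Fin (n - k) → Fin n → ℂ, Measurable f ∧
      ∀ x, ((A x, sortedEigenvalues (hherm x) ⟨k - 1, hlt⟩), f x) ∈ goodRel n (n - k) := by
  let : MeasurableSpace (Matrix (Fin n) (Fin n) ℂ) :=
    (MeasurableSpace.pi : MeasurableSpace (Fin n → Fin n → ℂ))
  have : BorelSpace (Matrix (Fin n) (Fin n) ℂ) :=
    inferInstanceAs (BorelSpace (Fin n → Fin n → ℂ))
  have : SecondCountableTopology (Matrix (Fin n) (Fin n) ℂ) :=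
    inferInstanceAs (SecondCountableTopology (Fin n → Fin n → ℂ))
  have hAm : Measurable A := measurable_pi_iff.2 fun i => measurable_pi_iff.2 fun j => hmeas i j
  let E := Fin (n - k) → Fin n → ℂ
  let K : Set E := Metric.closedBall 0 1
  have hK : IsCompact K := isCompact_closedBall 0 1
  have hlam : Measurable fun x => sortedEigenvalues (hherm x) ⟨k - 1, hlt⟩ := by
    refine measurable_of_Iic fun t => ?_
    have h1 : Measurable fun x => (A x, t) := hAm.prodMk measurable_const
    have h2 := h1 (isClosed_hit _ (isClosed_goodRel n (n - k)) K hK).measurableSet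
    convert h2 using 1
    ext x
    constructor
    · intro h
      exact exists_good (hherm x) k hk1 hkn hlt t h
    · rintro ⟨w, -, hw⟩
      exact sorted_le_of_good (hherm x) k hk1 hkn hlt t w hw
  let p : Ω → Matrix (Fin n) (Fin n) ℂ × ℝ :=
    fun x => (A x, sortedEigenvalues (hherm x) ⟨k - 1, hlt⟩)
  have hp : Measurable p := hAm.prodMk hlam
  obtain ⟨f, hf, hfF⟩ := measurable_selection (E := E)
    (ι := Bool × Fin (n - k) × Fin n) (fun x => K ∩ {w | (p x, w) ∈ goodRel n (n - k)})
    (fun x => hK.inter_right ((isClosed_goodRel n (n - k)).preimage (by fun_prop)))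
    (fun x => by
      obtain ⟨w, h1, h2⟩ := exists_good (hherm x) k hk1 hkn hlt _ le_rfl
      exact ⟨w, h1, h2⟩)
    (fun C hC => by
      have h2 := hp (isClosed_hit _ (isClosed_goodRel n (n - k)) (K ∩ C)
        (hK.inter_right hC)).measurableSet
      convert h2 using 1
      ext x
      constructor
      · rintro ⟨w, ⟨h1, h2⟩, h3⟩
        exact ⟨w, ⟨h1, h3⟩, h2⟩
      · rintro ⟨w, ⟨h1, h3⟩, h2⟩
        exact ⟨w, ⟨h1, h2⟩, h3⟩)
    (fun i w => if i.1 then (w i.2.1 i.2.2).re else (w i.2.1 i.2.2).im)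
    (by
      rintro ⟨b, i, j⟩
      cases b
      · simp only [Bool.false_eq_true, if_false]
        exact Complex.continuous_im.comp (by fun_prop)
      · simp only [if_true]
        exact Complex.continuous_re.comp (by fun_prop))
    (by
      intro y z h
      funext i j
      apply Complex.ext
      · simpa using h (true, i, j)
      · simpa using h (false, i, j))
  exact ⟨f, hf, fun x => (hfF x).2⟩

/-- Courant–Fischer for random Hermitian matrices: for every family of `n - k`
measurable random vectors `w_i`, at each `x` the `k`-th smallest eigenvalue is at most the
supremum of Rayleigh quotients over nonzero `v` orthogonal to the `w_i(x)`, and there is a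
measurable family of random vectors realizing equality at every point of `Ω`. -/
theorem random_courant_fischer
    {Ω : Type*} [MeasurableSpace Ω] (μ : Measure Ω) [SigmaFinite μ]
    (n k : ℕ) (hk1 : 1 ≤ k) (hkn : k ≤ n)
    (A : Ω → Matrix (Fin n) (Fin n) ℂ)
    (hmeas : ∀ i j, Measurable fun x => A x i j)
    (hherm : ∀ x, (A x).IsHermitian) :
    (∀ w : Fin (n - k) → Ω → (Fin n → ℂ),
      (∀ i j, Measurable fun x => w i x j) →
      ∀ x, sortedEigenvalues (hherm x) ⟨k - 1, by omega⟩ ≤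
        sSup {r : ℝ | ∃ v : Fin n → ℂ, v ≠ 0 ∧ (∀ i, star (w i x) ⬝ᵥ v = 0) ∧
          r = (star v ⬝ᵥ (A x *ᵥ v)).re / (star v ⬝ᵥ v).re}) ∧
    (∃ w : Fin (n - k) → Ω → (Fin n → ℂ),
      (∀ i j, Measurable fun x => w i x j) ∧
      ∀ x, sortedEigenvalues (hherm x) ⟨k - 1, by omega⟩ =
        sSup {r : ℝ | ∃ v : Fin n → ℂ, v ≠ 0 ∧ (∀ i, star (w i x) ⬝ᵥ v = 0) ∧
          r = (star v ⬝ᵥ (A x *ᵥ v)).re / (star v ⬝ᵥ v).re}) := by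
  refine ⟨fun w _ x => le_sup (hherm x) k hk1 hkn (by omega) (fun i => w i x), ?_⟩
  obtain ⟨f, hf, hgood⟩ := exists_measurable_good n k hk1 hkn (by omega) A hmeas hherm
  refine ⟨fun i x => f x i, fun i j => ?_, fun x => ?_⟩
  · exact measurable_pi_iff.1 (measurable_pi_iff.1 hf i) j
  · refine le_antisymm (le_sup (hherm x) k hk1 hkn (by omega) (f x)) (csSup_le ?_ ?_)
    · obtain ⟨v, hv0, hv, -⟩ := exists_lower (hherm x) k hk1 hkn (by omega) (f x)
      exact ⟨_, v, hv0, hv, rfl⟩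
    · rintro r ⟨v, hv0, hv, rfl⟩
      rw [div_le_iff₀ (star_dot_pos v hv0)]
      have := hgood x v
      simpa only [resid_of_orth (f x) v hv] using this
end
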